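/- Let K be a locally κ-presentable category (κ a regular cardinal). If a morphism g in K has the right lifting property with respect to all morphisms between κ-presentable objects, then g is an isomorphism. Consequently, the trivial combinatorial structure on K, in which every morphism is a cofibration, is cofibrantly generated by the set of morphisms between κ-presentable objects, i.e., it is κ-combinatorial. -/

import Mathlib

open CategoryTheory CategoryTheory.Limits

universe w v u

namespace PaperAcc

/-- A category `J` is `κ`-filtered if every diagram indexed by a category with fewer than `κ`
arrows admits a cocone. -/
def IsCardinalFiltered (J : Type v) [Category.{v} J] (κ : Cardinal.{v}) : Prop :=
  ∀ (A : Type v) [SmallCategory A], Cardinal.mk (Arrow A) < κ →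
    ∀ F : A ⥤ J, Nonempty (Cocone F)

/-- A preorder `P` is `κ`-directed if every subset of cardinality `< κ` has an upper bound. -/
def IsCardinalDirected (P : Type v) [Preorder P] (κ : Cardinal.{v}) : Prop :=
  ∀ S : Set P, Cardinal.mk S < κ → ∃ p : P, ∀ s ∈ S, s ≤ p

/-- An object `X` is `κ`-presentable if `Hom(X, -)` preserves `κ`-filtered colimits. -/
def IsPresentable {M : Type u} [Category.{v} M] (κ : Cardinal.{v}) (X : M) : Prop :=
  ∀ (J : Type v) [SmallCategory J], IsCardinalFiltered J κ →
    Nonempty (PreservesColimitsOfShape J (coyoneda.obj (Opposite.op X)))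

/-- A presentation of `X` as a `κ`-filtered colimit of objects belonging to `P`. -/
structure FilteredColimitPresentation {M : Type u} [Category.{v} M] (κ : Cardinal.{v})
    (P : Set M) (X : M) where
  J : Type v
  [instJ : SmallCategory J]
  filtered : IsCardinalFiltered J κ
  F : J ⥤ M
  mem : ∀ j, F.obj j ∈ P
  c : Cocone F
  isColimit : IsColimit c
  iso : c.pt ≅ X

/-- A presentation of `X` as a `κ`-directed colimit of objects belonging to `P`. -/
structure DirectedColimitPresentation {M : Type u} [Category.{v} M] (κ : Cardinal.{v})
    (P : Set M) (X : M) where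
  J : Type v
  [instJ : Preorder J]
  directed : IsCardinalDirected J κ
  F : J ⥤ M
  mem : ∀ j, F.obj j ∈ P
  c : Cocone F
  isColimit : IsColimit c
  iso : c.pt ≅ X

/-- A class of arrows (viewed as a full subcategory of the arrow category) is closed under
`κ`-filtered colimits. -/
def ClosedUnderFilteredColimits {M : Type u} [Category.{v} M] (κ : Cardinal.{v})
    (P : Set (Arrow M)) : Prop :=
  ∀ (J : Type v) [SmallCategory J], IsCardinalFiltered J κ →
    ∀ (F : J ⥤ Arrow M) (c : Cocone F), IsColimit c → (∀ j, F.obj j ∈ P) → c.pt ∈ P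

/-- The morphisms having the right lifting property with respect to every member of the
family `f`. -/
def RlpOf {M : Type u} [Category.{v} M] {ι : Type w} {A B : ι → M}
    (f : ∀ i, A i ⟶ B i) : MorphismProperty M :=
  fun _ _ g => ∀ i, HasLiftingProperty (f i) g

/-- The morphisms having the left lifting property with respect to every morphism in `P`. -/
def Llp {M : Type u} [Category.{v} M] (P : MorphismProperty M) : MorphismProperty M :=
  fun _ _ g => ∀ ⦃X Y : M⦄ (p : X ⟶ Y), P p → HasLiftingProperty g p

/-- The class `C` is cofibrantly generated by a set of morphisms between `κ`-presentable
objects: `C = llp(rlp(I))` for such a set `I`. -/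
def CofibrantlyGeneratedByPresentables {M : Type u} [Category.{v} M] (κ : Cardinal.{v})
    (C : MorphismProperty M) : Prop :=
  ∃ (ι : Type v) (A B : ι → M) (f : ∀ i, A i ⟶ B i),
    (∀ i, IsPresentable κ (A i)) ∧ (∀ i, IsPresentable κ (B i)) ∧
      C = Llp (RlpOf f)

/-- A category is locally `κ`-presentable: it is cocomplete and has a set of `κ`-presentable
objects such that every object is a `κ`-filtered colimit of objects from this set. -/
def IsLocallyPresentable (M : Type u) [Category.{v} M] (κ : Cardinal.{v}) : Prop :=
  HasColimits M ∧
    ∃ (ι : Type v) (G : ι → M), (∀ i, IsPresentable κ (G i)) ∧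
      ∀ X : M, Nonempty (FilteredColimitPresentation κ (Set.range G) X)

/-- A class of morphisms is stable under retracts (in the arrow category). -/
def IsStableUnderRetracts {M : Type u} [Category.{v} M] (P : MorphismProperty M) : Prop :=
  ∀ {X Y X' Y' : M} (f : X ⟶ Y) (g : X' ⟶ Y') (iX : X ⟶ X') (rX : X' ⟶ X)
    (iY : Y ⟶ Y') (rY : Y' ⟶ Y), iX ≫ rX = 𝟙 X → iY ≫ rY = 𝟙 Y →
    iX ≫ g = f ≫ iY → rX ≫ f = g ≫ rY → P g → P f

/-- A model structure on a category: classes of weak equivalences, cofibrations and fibrations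
satisfying the axioms of a (closed) model category. -/
structure ModelStructure (M : Type u) [Category.{v} M] where
  W : MorphismProperty M
  Cof : MorphismProperty M
  Fib : MorphismProperty M
  W_id : ∀ X : M, W (𝟙 X)
  W_comp : ∀ {X Y Z : M} (f : X ⟶ Y) (g : Y ⟶ Z), W f → W g → W (f ≫ g)
  W_of_comp_right : ∀ {X Y Z : M} (f : X ⟶ Y) (g : Y ⟶ Z), W g → W (f ≫ g) → W f
  W_of_comp_left : ∀ {X Y Z : M} (f : X ⟶ Y) (g : Y ⟶ Z), W f → W (f ≫ g) → W g
  W_retract : IsStableUnderRetracts W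
  Cof_retract : IsStableUnderRetracts Cof
  Fib_retract : IsStableUnderRetracts Fib
  lift_trivCof_fib : ∀ {A B X Y : M} (i : A ⟶ B) (p : X ⟶ Y),
    Cof i → W i → Fib p → HasLiftingProperty i p
  lift_cof_trivFib : ∀ {A B X Y : M} (i : A ⟶ B) (p : X ⟶ Y),
    Cof i → Fib p → W p → HasLiftingProperty i p
  fact_cof_trivFib : ∀ {X Y : M} (f : X ⟶ Y),
    ∃ (Z : M) (i : X ⟶ Z) (p : Z ⟶ Y), Cof i ∧ Fib p ∧ W p ∧ i ≫ p = f
  fact_trivCof_fib : ∀ {X Y : M} (f : X ⟶ Y),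
    ∃ (Z : M) (i : X ⟶ Z) (p : Z ⟶ Y), Cof i ∧ W i ∧ Fib p ∧ i ≫ p = f

/-- A model structure is `κ`-combinatorial if the underlying category is locally
`κ`-presentable and both cofibrations and trivial cofibrations are cofibrantly generated
by sets of morphisms between `κ`-presentable objects. -/
structure IsCombinatorial {M : Type u} [Category.{v} M] (S : ModelStructure M)
    (κ : Cardinal.{v}) : Prop where
  isRegular : κ.IsRegular
  locallyPresentable : IsLocallyPresentable M κ
  cofGenerated : CofibrantlyGeneratedByPresentables κ S.Cof
  trivCofGenerated : CofibrantlyGeneratedByPresentables κ (S.Cof ⊓ S.W)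

/-- An object is cofibrant if the morphism from an(y) initial object to it is a cofibration. -/
def Cofibrant {M : Type u} [Category.{v} M] (S : ModelStructure M) (X : M) : Prop :=
  ∀ ⦃O : M⦄, IsInitial O → ∀ f : O ⟶ X, S.Cof f

/-- A cylinder object for `X`: a factorization `X ⊔ X → C → X` of the codiagonal into
a cofibration followed by a weak equivalence. -/
structure CylinderObject {M : Type u} [Category.{v} M] (S : ModelStructure M) (X : M) where
  C : M
  i₀ : X ⟶ C
  i₁ : X ⟶ C
  p : C ⟶ X
  hi₀ : i₀ ≫ p = 𝟙 X
  hi₁ : i₁ ≫ p = 𝟙 X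
  hp : S.W p
  hcof : ∀ (c : BinaryCofan X X) (hc : IsColimit c), S.Cof (hc.desc (BinaryCofan.mk i₀ i₁))

/-- A commutative square on `(f, g, h, k)` (with `f : A ⟶ B`, `g : A ⟶ X`, `h : B ⟶ Y`,
`k : X ⟶ Y`) is a homotopy pushout: for some (equivalently, any) replacement of the span
`B ← A → X` by a span of cofibrations between cofibrant objects which is weakly equivalent
to it, the comparison morphism from the (strict) pushout of the replacement to `Y` is a
weak equivalence. -/
def IsHomotopyPushout {M : Type u} [Category.{v} M] (S : ModelStructure M)
    {A B X Y : M} (f : A ⟶ B) (g : A ⟶ X) (h : B ⟶ Y) (k : X ⟶ Y) : Prop :=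
  ∃ (A' B' X' P : M) (wA : A' ⟶ A) (i : A' ⟶ B') (wB : B' ⟶ B)
    (j : A' ⟶ X') (wX : X' ⟶ X) (pB : B' ⟶ P) (pX : X' ⟶ P) (m : P ⟶ Y),
      Cofibrant S A' ∧ S.W wA ∧ S.Cof i ∧ S.W wB ∧ S.Cof j ∧ S.W wX ∧
      i ≫ wB = wA ≫ f ∧ j ≫ wX = wA ≫ g ∧
      IsPushout i j pB pX ∧ pB ≫ m = wB ≫ h ∧ pX ≫ m = wX ≫ k ∧ S.W m

/-- A morphism `i : A ⟶ B` is a formal cofibration if every pushout square of `i` along a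
morphism `f : A ⟶ X` with `X` cofibrant is a homotopy pushout. -/
def IsFormalCofibration {M : Type u} [Category.{v} M] (S : ModelStructure M)
    {A B : M} (i : A ⟶ B) : Prop :=
  ∀ {X Y : M} (f : A ⟶ X) (g : B ⟶ Y) (k : X ⟶ Y),
    Cofibrant S X → IsPushout i f g k → IsHomotopyPushout S i f g k

/-- The set of arrows satisfying `P` whose domain and codomain are `κ`-presentable. -/
def PresentableArrowsIn {M : Type u} [Category.{v} M] (κ : Cardinal.{v})
    (P : Set (Arrow M)) : Set (Arrow M) :=
  {a | a ∈ P ∧ IsPresentable κ a.left ∧ IsPresentable κ a.right}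

end PaperAcc

namespace PaperAcc

/-- The morphisms having the right lifting property with respect to every morphism in `P`. -/
def Rlp {M : Type u} [Category.{v} M] (P : MorphismProperty M) : MorphismProperty M :=
  fun _ _ g => ∀ ⦃X Y : M⦄ (i : X ⟶ Y), P i → HasLiftingProperty i g

/-- The class of morphisms whose domain and codomain are `κ`-presentable. -/
def PresentableMorphisms (M : Type u) [Category.{v} M] (κ : Cardinal.{v}) :
    MorphismProperty M :=
  fun A B _ => IsPresentable κ A ∧ IsPresentable κ B

theorem isCardinalFiltered_iff (J : Type v) [SmallCategory J] (κ : Cardinal.{v})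
    [Fact κ.IsRegular] :
    IsCardinalFiltered J κ ↔ CategoryTheory.IsCardinalFiltered J κ :=
  ⟨fun h ↦ ⟨fun F hA ↦ h _ ((hasCardinalLT_iff_cardinal_mk_lt _ _).1 hA) F⟩,
    fun h _ _ hA F ↦ h.nonempty_cocone F ((hasCardinalLT_iff_cardinal_mk_lt _ _).2 hA)⟩

theorem isPresentable_iff {K : Type u} [Category.{v} K] (κ : Cardinal.{v}) [Fact κ.IsRegular]
    (X : K) : IsPresentable κ X ↔ IsCardinalPresentable X κ :=
  ⟨fun h ↦ ⟨fun J _ hJ ↦ (h J ((isCardinalFiltered_iff J κ).2 hJ)).some⟩,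
    fun h J _ hJ ↦ by
      have := (isCardinalFiltered_iff J κ).1 hJ
      exact ⟨preservesColimitsOfShape_of_isCardinalPresentable X κ J⟩⟩

/-- A colimit of `κ`-presentable objects over a finite discrete shape is `κ`-presentable. -/
theorem isPresentable_of_isColimit_discrete {K : Type u} [Category.{v} K] {κ : Cardinal.{v}}
    (hκ : κ.IsRegular) {T : Type} [Finite T] {F : Discrete T ⥤ K} {c : Cocone F}
    (hc : IsColimit c) (hF : ∀ t, IsPresentable κ (F.obj t)) : IsPresentable κ c.pt := by
  have : Fact κ.IsRegular := ⟨hκ⟩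
  have (t : Discrete T) : IsCardinalPresentable (F.obj t) κ := (isPresentable_iff κ _).1 (hF t)
  rw [isPresentable_iff]
  refine isCardinalPresentable_of_isColimit c hc κ ?_
  rw [hasCardinalLT_arrow_discrete_iff]
  exact hasCardinalLT_of_finite T κ hκ.aleph0_le

theorem isPresentable_initial {K : Type u} [Category.{v} K] [HasInitial K] {κ : Cardinal.{v}}
    (hκ : κ.IsRegular) : IsPresentable κ (⊥_ K) :=
  isPresentable_of_isColimit_discrete hκ (colimit.isColimit (Functor.empty K)) (fun t ↦ t.as.elim)

theorem isPresentable_coprod {K : Type u} [Category.{v} K] {κ : Cardinal.{v}}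
    (hκ : κ.IsRegular) {X Y : K} [HasBinaryCoproduct X Y] (hX : IsPresentable κ X)
    (hY : IsPresentable κ Y) : IsPresentable κ (X ⨿ Y) :=
  isPresentable_of_isColimit_discrete hκ (colimit.isColimit (pair X Y))
    (by rintro ⟨_ | _⟩ <;> assumption)

theorem isStrongGenerator_of_presentation {K : Type u} [Category.{v} K] {κ : Cardinal.{v}}
    {P : Set K} (h : ∀ X : K, Nonempty (FilteredColimitPresentation κ P X)) :
    ObjectProperty.IsStrongGenerator (C := K) (fun X ↦ X ∈ P) := by
  refine .mk_of_exists_colimitsOfShape.{v} fun X ↦ ?_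
  obtain ⟨p⟩ := h X
  let := p.instJ
  exact ⟨p.J, p.instJ, ObjectProperty.prop_of_iso _ p.iso
    ⟨{ diag := p.F, ι := p.c.ι, isColimit := p.isColimit, prop_diag_obj := p.mem }⟩⟩

/-- A morphism with the right lifting property with respect to `⊥_ K ⟶ A` and the codiagonal
`A ⨿ A ⟶ A`, for all members `A` of a strong generator, is an isomorphism. -/
theorem isIso_of_hasLiftingProperty_of_isStrongGenerator {K : Type u} [Category.{v} K]
    [HasInitial K] [HasBinaryCoproducts K] {P : ObjectProperty K} (hP : P.IsStrongGenerator)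
    {X Y : K} (g : X ⟶ Y) (hinit : ∀ A, P A → HasLiftingProperty (initial.to A) g)
    (hcodiag : ∀ A, P A → HasLiftingProperty (codiag A) g) : IsIso g := by
  have : Mono g := by
    refine ⟨fun {Z} a b hab ↦ hP.isSeparating _ _ fun A hA t ↦ ?_⟩
    have := hcodiag A hA
    have sq : CommSq (coprod.desc (t ≫ a) (t ≫ b)) (codiag A) g (t ≫ a ≫ g) :=
      ⟨by ext <;> simp [hab]⟩
    obtain ⟨l, hl⟩ : ∃ l : A ⟶ X, codiag A ≫ l = coprod.desc (t ≫ a) (t ≫ b) :=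
      ⟨sq.lift, sq.fac_left⟩
    have hinl := coprod.inl ≫= hl
    have hinr := coprod.inr ≫= hl
    simp only [codiag, coprod.inl_desc_assoc, coprod.inr_desc_assoc, coprod.inl_desc,
      coprod.inr_desc] at hinl hinr
    exact hinl.symm.trans hinr
  refine hP.isIso_of_mono g fun A hA t ↦ ?_
  have := hinit A hA
  have sq : CommSq (initial.to X) (initial.to A) g t := ⟨by ext⟩
  exact ⟨sq.lift, sq.fac_right⟩

theorem llp_eq_top {K : Type u} [Category.{v} K] {P : MorphismProperty K}
    (hP : P ≤ MorphismProperty.isomorphisms K) : Llp P = ⊤ := by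
  refine top_le_iff.1 fun _ _ _ _ _ _ p hp ↦ ?_
  have : IsIso p := hP p hp
  infer_instance

/-- Lemma 3.1. Let `K` be a locally `κ`-presentable category. If a morphism
`g` has the right lifting property with respect to all morphisms between `κ`-presentable
objects, then `g` is an isomorphism. Consequently, the trivial combinatorial structure on `K`
(in which every morphism is a cofibration) is cofibrantly generated by the set of morphisms
between `κ`-presentable objects, i.e. it is `κ`-combinatorial. -/
theorem statement5 {K : Type u} [Category.{v} K] (κ : Cardinal.{v}) (hκ : κ.IsRegular)
    (hlp : IsLocallyPresentable K κ) :
    (∀ {X Y : K} (g : X ⟶ Y),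
      (∀ {A B : K} (i : A ⟶ B), IsPresentable κ A → IsPresentable κ B →
        HasLiftingProperty i g) → IsIso g) ∧
    Llp (Rlp (PresentableMorphisms K κ)) = (⊤ : MorphismProperty K) ∧
    CofibrantlyGeneratedByPresentables κ (⊤ : MorphismProperty K) := by
  obtain ⟨_, ι, G, hG, hpres⟩ := hlp
  have hgen := isStrongGenerator_of_presentation hpres
  have hiso {X Y : K} (g : X ⟶ Y)
      (h : ∀ {A B : K} (i : A ⟶ B), IsPresentable κ A → IsPresentable κ B →
        HasLiftingProperty i g) : IsIso g := by
    refine isIso_of_hasLiftingProperty_of_isStrongGenerator hgen g ?_ ?_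
    · rintro _ ⟨i, rfl⟩
      exact h _ (isPresentable_initial hκ) (hG i)
    · rintro _ ⟨i, rfl⟩
      exact h _ (isPresentable_coprod hκ (hG i) (hG i)) (hG i)
  refine ⟨hiso, llp_eq_top fun _ _ g hg ↦ hiso g fun i hA hB ↦ hg i ⟨hA, hB⟩, ?_⟩
  refine ⟨ι ⊕ ι, Sum.elim (fun _ ↦ ⊥_ K) (fun i ↦ G i ⨿ G i), Sum.elim G G,
    Sum.rec (fun i ↦ initial.to (G i)) (fun i ↦ codiag (G i)), ?_, ?_,
    (llp_eq_top fun _ _ g hg ↦ ?_).symm⟩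
  · rintro (i | i)
    exacts [isPresentable_initial hκ, isPresentable_coprod hκ (hG i) (hG i)]
  · rintro (i | i) <;> exact hG i
  · refine isIso_of_hasLiftingProperty_of_isStrongGenerator hgen g ?_ ?_
    · rintro _ ⟨i, rfl⟩
      exact hg (.inl i)
    · rintro _ ⟨i, rfl⟩
      exact hg (.inr i)

end PaperAcc
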